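/- Let n be a positive integer, d ∈ {1,…,n}, and G = H_2^n(d). Then θ(complement of G) ≥ 2^n / M, where M is the maximum of 2^n·g(0) over all functions g : {0,1}^n → ℝ with g(z) ≥ 0 for all z, 2^n·ĝ(0) = 1 (i.e., ∑_z g(z) = 1), and ĝ(x) = 0 for all x with Hamming weight |x| ≥ d. -/

import Mathlib

open Finset

/-- The real Fourier coefficient of `g : {0,1}^n → ℝ` at `z`:
`ĝ(z) = 2^{-n} ∑_x g(x) (-1)^{z·x}`. -/
noncomputable def fourierCoeff17 (n : ℕ) (g : (Fin n → ZMod 2) → ℝ)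
    (z : Fin n → ZMod 2) : ℝ :=
  (2 : ℝ)⁻¹ ^ n * ∑ x : Fin n → ZMod 2, g x * (-1 : ℝ) ^ (∑ i, (z i).val * (x i).val)

/-- The Lovász theta number of the complement of `H_2^n(d)`: two distinct
strings are adjacent in the complement iff their Hamming distance is `< d`. -/
noncomputable def thetaCompl17 (n d : ℕ) : ℝ :=
  sSup {t : ℝ | ∃ X : Matrix (Fin n → ZMod 2) (Fin n → ZMod 2) ℝ,
    X.PosSemidef ∧ X.trace = 1 ∧
    (∀ x y, x ≠ y → hammingDist x y < d → X x y = 0) ∧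
    t = ∑ x : Fin n → ZMod 2, ∑ y : Fin n → ZMod 2, X x y}

/-- The character `z ↦ (-1)^{x·z}` of `{0,1}^n`. -/
noncomputable def cubeChar {n : ℕ} (x z : Fin n → ZMod 2) : ℝ :=
  (-1 : ℝ) ^ (∑ i, (x i).val * (z i).val)

theorem cubeChar_eq_prod {n : ℕ} (x z : Fin n → ZMod 2) :
    cubeChar x z = ∏ i, (-1 : ℝ) ^ ((x i).val * (z i).val) :=
  (Finset.prod_pow_eq_pow_sum _ _ _).symm

theorem cubeChar_comm {n : ℕ} (x z : Fin n → ZMod 2) : cubeChar x z = cubeChar z x := by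
  simp only [cubeChar, mul_comm]

theorem cubeChar_add {n : ℕ} (x y z : Fin n → ZMod 2) :
    cubeChar (x + y) z = cubeChar x z * cubeChar y z := by
  simp only [cubeChar_eq_prod, ← Finset.prod_mul_distrib, Pi.add_apply]
  refine Finset.prod_congr rfl fun i _ => ?_
  generalize x i = a
  generalize y i = b
  generalize z i = c
  have h : ∀ a b c : ZMod 2,
      ((a + b).val * c.val) % 2 = (a.val * c.val + b.val * c.val) % 2 := by decide
  rw [← pow_add, neg_one_pow_eq_pow_mod_two, h, ← neg_one_pow_eq_pow_mod_two]

theorem cubeChar_zero_right {n : ℕ} (x : Fin n → ZMod 2) : cubeChar x 0 = 1 := by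
  simp [cubeChar]

theorem cubeChar_zero_left {n : ℕ} (z : Fin n → ZMod 2) : cubeChar 0 z = 1 := by
  simp [cubeChar]

theorem card_cube (n : ℕ) : (Fintype.card (Fin n → ZMod 2) : ℝ) = 2 ^ n := by
  simp [ZMod.card]

theorem sum_cubeChar_of_ne_zero {n : ℕ} {x : Fin n → ZMod 2} (hx : x ≠ 0) :
    ∑ z, cubeChar x z = 0 := by
  obtain ⟨i, hi⟩ := Function.ne_iff.1 hx
  have hi1 : x i = 1 := by
    revert hi
    generalize x i = a
    simp only [Pi.zero_apply]
    revert a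
    decide
  have hs : cubeChar x (Pi.single i 1) = -1 := by
    rw [cubeChar, Finset.sum_eq_single i]
    · simp [hi1, ZMod.val_one]
    · intro j _ hj
      simp [Pi.single_eq_of_ne hj]
    · simp
  have h : ∑ z, cubeChar x (Pi.single i 1 + z) = ∑ z, cubeChar x z :=
    Equiv.sum_comp (Equiv.addLeft (Pi.single i 1)) (cubeChar x)
  have h2 : ∀ z, cubeChar x (Pi.single i 1 + z) = -cubeChar x z := fun z => by
    rw [cubeChar_comm, cubeChar_add, cubeChar_comm _ x, hs, cubeChar_comm z]
    ring
  simp only [h2, Finset.sum_neg_distrib] at h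
  linarith

theorem sum_cubeChar_zero {n : ℕ} : ∑ z, cubeChar (0 : Fin n → ZMod 2) z = 2 ^ n := by
  simp [cubeChar_zero_left, ZMod.card]

theorem sum_val_add_eq_hammingDist {n : ℕ} (x y : Fin n → ZMod 2) :
    ∑ i, ((x + y) i).val = hammingDist x y := by
  rw [hammingDist, Finset.card_filter]
  refine Finset.sum_congr rfl fun i _ => ?_
  rw [Pi.add_apply]
  generalize x i = a
  generalize y i = b
  revert a b
  decide

theorem cube_add_eq_zero_iff {n : ℕ} {x y : Fin n → ZMod 2} : x + y = 0 ↔ x = y := by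
  rw [add_eq_zero_iff_eq_neg]
  simp only [funext_iff, Pi.neg_apply, ZMod.neg_eq_self_mod_two]

theorem posSemidef_sum_le_card_mul_trace {ι : Type*} [Fintype ι] {X : Matrix ι ι ℝ}
    (hX : X.PosSemidef) : ∑ x, ∑ y, X x y ≤ Fintype.card ι * X.trace := by
  classical
  have key : ∀ x y, X x y ≤ (X x x + X y y) / 2 := fun x y => by
    have h := hX.dotProduct_mulVec_nonneg (Pi.single x 1 - Pi.single y 1)
    have hs : X y x = X x y := by simpa using hX.isHermitian.apply x y
    simp [Matrix.mulVec_sub, sub_dotProduct, hs] at h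
    linarith
  calc ∑ x, ∑ y, X x y ≤ ∑ x, ∑ y, (X x x + X y y) / 2 :=
        Finset.sum_le_sum fun x _ => Finset.sum_le_sum fun y _ => key x y
    _ = Fintype.card ι * X.trace := by
        simp only [← Finset.sum_div, Finset.sum_add_distrib, Finset.sum_const, Finset.card_univ,
          nsmul_eq_mul, Matrix.trace, Matrix.diag, ← Finset.mul_sum]
        ring

theorem le_thetaCompl17 {n d : ℕ} {X : Matrix (Fin n → ZMod 2) (Fin n → ZMod 2) ℝ}
    (hX : X.PosSemidef) (htr : X.trace = 1)
    (h0 : ∀ x y, x ≠ y → hammingDist x y < d → X x y = 0) :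
    ∑ x, ∑ y, X x y ≤ thetaCompl17 n d := by
  refine le_csSup ⟨(2 : ℝ) ^ n, ?_⟩ ⟨X, hX, htr, h0, rfl⟩
  rintro t ⟨Y, hY, htrY, -, rfl⟩
  have h := posSemidef_sum_le_card_mul_trace hY
  rwa [htrY, mul_one, card_cube] at h

/-- A nonnegative function whose nonzero Fourier coefficients of weight `< d` vanish yields
a feasible point for the theta number of the complement. -/
theorem div_le_thetaCompl17 {n d : ℕ} {w : (Fin n → ZMod 2) → ℝ} {v : ℝ} (hv : 0 < v)
    (hw : ∀ z, 0 ≤ w z) (hsum : ∑ z, w z = 2 ^ n * v)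
    (h0 : ∀ x : Fin n → ZMod 2, x ≠ 0 → ∑ i, (x i).val < d → ∑ z, w z * cubeChar x z = 0) :
    w 0 / v ≤ thetaCompl17 n d := by
  set c : ℝ := ((2 ^ n) ^ 2 * v)⁻¹ with hc
  have hc0 : 0 ≤ c := by positivity
  let B : Matrix (Fin n → ZMod 2) (Fin n → ZMod 2) ℝ :=
    Matrix.of fun z x => √(c * w z) * cubeChar x z
  have hB : ∀ x y, (B.conjTranspose * B) x y = c * ∑ z, w z * cubeChar (x + y) z := fun x y => by
    rw [Matrix.mul_apply, Finset.mul_sum]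
    refine Finset.sum_congr rfl fun z _ => ?_
    have h := Real.mul_self_sqrt (mul_nonneg hc0 (hw z))
    simp only [B, Matrix.conjTranspose_apply, Matrix.of_apply, star_trivial, cubeChar_add]
    linear_combination cubeChar x z * cubeChar y z * h
  have htr : (B.conjTranspose * B).trace = 1 := by
    have : ∀ x, (B.conjTranspose * B) x x = c * (2 ^ n * v) := fun x => by
      rw [hB, cube_add_eq_zero_iff.2 rfl, ← hsum]
      simp only [cubeChar_zero_left, mul_one]
    simp only [Matrix.trace, Matrix.diag, this, Finset.sum_const, Finset.card_univ, nsmul_eq_mul,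
      card_cube]
    rw [hc]
    field_simp
  have hval : ∑ x, ∑ y, (B.conjTranspose * B) x y = w 0 / v := by
    have hz : ∀ z : Fin n → ZMod 2, z ≠ 0 → ∑ x, cubeChar x z = 0 := fun z hz => by
      simp only [cubeChar_comm _ z, sum_cubeChar_of_ne_zero hz]
    calc ∑ x, ∑ y, (B.conjTranspose * B) x y
        = ∑ x, ∑ y, ∑ z, c * w z * cubeChar x z * cubeChar y z := by
          simp only [hB, Finset.mul_sum, cubeChar_add, mul_assoc]
      _ = ∑ z, c * w z * (∑ x, cubeChar x z) * ∑ y, cubeChar y z := by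
          simp only [Finset.sum_comm (s := Finset.univ (α := Fin n → ZMod 2)) (t := Finset.univ)
            (f := fun y z => c * w z * cubeChar _ z * cubeChar y z), ← Finset.mul_sum]
          rw [Finset.sum_comm]
          simp only [← Finset.mul_sum, ← Finset.sum_mul]
      _ = w 0 / v := by
          rw [Finset.sum_eq_single 0]
          · simp only [cubeChar_zero_right, Finset.sum_const, Finset.card_univ, nsmul_eq_mul,
              card_cube, hc]
            field_simp
          · intro z _ hz0
            rw [hz z hz0, mul_zero]
          · simp
  rw [← hval]
  refine le_thetaCompl17 (Matrix.posSemidef_conjTranspose_mul_self B) htr fun x y hxy hd => ?_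
  rw [hB, h0 _ (mt cube_add_eq_zero_iff.1 hxy) (by rwa [sum_val_add_eq_hammingDist]), mul_zero]

/-- Linear programming duality: if every admissible `g` has `g 0 < v`, there is a dual
certificate of value `v`. -/
theorem exists_dual_certificate {n d : ℕ} (hd : 1 ≤ d) {v : ℝ}
    (h : ∀ g ∈ stdSimplex ℝ (Fin n → ZMod 2),
      (∀ x : Fin n → ZMod 2, d ≤ ∑ i, (x i).val → ∑ z, g z * cubeChar x z = 0) → g 0 < v) :
    ∃ a : (Fin n → ZMod 2) → ℝ, (∀ x, ∑ i, (x i).val < d → a x = 0) ∧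
      ∀ z, (if z = 0 then 1 else 0) ≤ v + ∑ x, a x * cubeChar x z := by
  let P : ((Fin n → ZMod 2) → ℝ) →ₗ[ℝ] ((Fin n → ZMod 2) → ℝ) × ℝ :=
    { toFun := fun g => (fun x => if d ≤ ∑ i, (x i).val then ∑ z, g z * cubeChar x z else 0,
        g 0 - v * ∑ z, g z)
      map_add' := fun g k => by
        ext x
        · simp only [Pi.add_apply, add_mul, Finset.sum_add_distrib, Prod.fst_add]
          split_ifs <;> simp
        · simp only [Pi.add_apply, Finset.sum_add_distrib, Prod.snd_add]
          ring
      map_smul' := fun r g => by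
        ext x
        · simp [mul_assoc, Finset.mul_sum]
        · simp only [Pi.smul_apply, smul_eq_mul, ← Finset.mul_sum, Prod.smul_snd,
            RingHom.id_apply]
          ring }
  let T : Set (((Fin n → ZMod 2) → ℝ) × ℝ) := {0} ×ˢ Set.Ici 0
  have hdisj : Disjoint (Set.image P (stdSimplex ℝ (Fin n → ZMod 2))) T := by
    rw [Set.disjoint_left]
    rintro _ ⟨g, hg, rfl⟩ ⟨h1, h2⟩
    have h3 := h g hg fun x hx => by
      have := congrFun (show (P g).1 = 0 from h1) x
      simpa [P, hx] using this
    have h4 : 0 ≤ g 0 - v * ∑ z, g z := h2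
    rw [hg.2] at h4
    linarith
  obtain ⟨f, r, s, hf, hrs, hT⟩ := geometric_hahn_banach_compact_closed
    ((convex_stdSimplex ℝ _).linear_image P)
    ((isCompact_stdSimplex ℝ _).image P.continuous_of_finiteDimensional)
    ((convex_singleton _).prod (convex_Ici _)) (isClosed_singleton.prod isClosed_Ici) hdisj
  set b : ℝ := f (0, 1) with hb
  have hsplit : ∀ p t, f (p, t) = ∑ x, p x * f (Pi.single x 1, 0) + t * b := fun p t => by
    have h1 : ((p, t) : ((Fin n → ZMod 2) → ℝ) × ℝ) =
        ∑ x, p x • ((Pi.single x 1 : (Fin n → ZMod 2) → ℝ), (0 : ℝ)) + t • (0, 1) := by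
      ext y
      · simp [Prod.fst_sum, Finset.sum_apply, Pi.single_apply]
      · simp [Prod.snd_sum]
    rw [h1, map_add, map_sum, map_smul]
    simp only [map_smul, smul_eq_mul, hb]
  have hs0 : s < 0 := by
    simpa using hT 0 ⟨rfl, le_refl (0 : ℝ)⟩
  have hneg : ∀ g ∈ stdSimplex ℝ (Fin n → ZMod 2), f (P g) < 0 := fun g hg =>
    (hf _ ⟨g, hg, rfl⟩).trans (hrs.trans hs0)
  have hb0 : 0 ≤ b := by
    by_contra! hlt
    have h1 := hT (0, s / b) ⟨rfl, (div_pos_of_neg_of_neg hs0 hlt).le⟩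
    rw [hsplit] at h1
    simp [div_mul_cancel₀ _ hlt.ne] at h1
  have hbpos : 0 < b := by
    refine hb0.lt_of_ne fun hbz => ?_
    have hu : (fun _ => (2 ^ n : ℝ)⁻¹) ∈ stdSimplex ℝ (Fin n → ZMod 2) :=
      ⟨fun _ => by positivity, by
        rw [Finset.sum_const, Finset.card_univ, nsmul_eq_mul, card_cube]
        field_simp⟩
    have h1 := hneg _ hu
    rw [← Prod.mk.eta (p := P _), hsplit, ← hbz, mul_zero, add_zero] at h1
    refine h1.ne (Finset.sum_eq_zero fun x _ => ?_)
    by_cases hx : d ≤ ∑ i, (x i).val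
    · have hx0 : x ≠ 0 := by
        rintro rfl
        simp only [Pi.zero_apply, ZMod.val_zero, Finset.sum_const_zero] at hx
        omega
      simp [P, ← Finset.mul_sum, sum_cubeChar_of_ne_zero hx0]
    · simp [P, hx]
  refine ⟨fun x => if d ≤ ∑ i, (x i).val then -(f (Pi.single x 1, 0) / b) else 0,
    fun x hx => if_neg hx.not_ge, fun z => ?_⟩
  have h1 := hneg _ (single_mem_stdSimplex ℝ z)
  rw [← Prod.mk.eta (p := P _), hsplit] at h1
  have h2 : ∑ x, (P (Pi.single z 1)).1 x * f (Pi.single x 1, 0) =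
      -b * ∑ x, (if d ≤ ∑ i, (x i).val then -(f (Pi.single x 1, 0) / b) else 0) *
        cubeChar x z := by
    rw [Finset.mul_sum]
    refine Finset.sum_congr rfl fun x _ => ?_
    by_cases hx : d ≤ ∑ i, (x i).val
    · simp [P, hx, Pi.single_apply]
      field_simp
    · simp [P, hx]
  have h3 : (P (Pi.single z 1)).2 = (if z = 0 then 1 else 0) - v := by
    simp [P, Pi.single_apply, eq_comm]
  rw [h2, h3] at h1
  nlinarith

/-- `θ(complement of H_2^n(d)) ≥ 2^n / M`, where `M` is the maximum of
`2^n g(0)` over nonnegative `g` summing to `1` whose Fourier coefficients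
vanish on weight `≥ d`. -/
theorem stmt_17 (n d : ℕ) (hn : 0 < n) (hd1 : 1 ≤ d) (hd2 : d ≤ n) :
    (2 : ℝ) ^ n / sSup {t : ℝ | ∃ g : (Fin n → ZMod 2) → ℝ,
        (∀ z, 0 ≤ g z) ∧
        (∑ z : Fin n → ZMod 2, g z) = 1 ∧
        (∀ x : Fin n → ZMod 2, d ≤ ∑ i, (x i).val → fourierCoeff17 n g x = 0) ∧
        t = (2 : ℝ) ^ n * g 0} ≤
      thetaCompl17 n d := by
  set S : Set ℝ := {t : ℝ | ∃ g : (Fin n → ZMod 2) → ℝ,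
        (∀ z, 0 ≤ g z) ∧
        (∑ z : Fin n → ZMod 2, g z) = 1 ∧
        (∀ x : Fin n → ZMod 2, d ≤ ∑ i, (x i).val → fourierCoeff17 n g x = 0) ∧
        t = (2 : ℝ) ^ n * g 0} with hS
  have hN : (0 : ℝ) < 2 ^ n := by positivity
  have hcoeff : ∀ (g : (Fin n → ZMod 2) → ℝ) x,
      fourierCoeff17 n g x = 0 ↔ ∑ z, g z * cubeChar x z = 0 := fun g x => by
    simp [fourierCoeff17, cubeChar]
  have hbdd : BddAbove S := by
    refine ⟨2 ^ n, ?_⟩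
    rintro t ⟨g, hg0, hg1, -, rfl⟩
    have : g 0 ≤ 1 := hg1 ▸ Finset.single_le_sum (fun z _ => hg0 z) (Finset.mem_univ 0)
    exact mul_le_of_le_one_right hN.le this
  have hM : 1 ≤ sSup S := by
    refine le_csSup hbdd ⟨fun _ => (2 ^ n)⁻¹, fun _ => by positivity, ?_, fun x hx => ?_, ?_⟩
    · rw [Finset.sum_const, Finset.card_univ, nsmul_eq_mul, card_cube]
      field_simp
    · have hx0 : x ≠ 0 := by
        rintro rfl
        simp only [Pi.zero_apply, ZMod.val_zero, Finset.sum_const_zero] at hx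
        omega
      rw [hcoeff, ← Finset.mul_sum, sum_cubeChar_of_ne_zero hx0, mul_zero]
    · field_simp
  have hdual : ∀ v, sSup S / 2 ^ n < v → 1 / v ≤ thetaCompl17 n d := fun v hv => by
    have hv0 : 0 < v := lt_trans (by positivity) hv
    obtain ⟨a, ha0, ha⟩ := exists_dual_certificate (n := n) hd1 (v := v) fun g hg hgx => by
      refine lt_of_le_of_lt ?_ hv
      rw [le_div_iff₀' hN]
      exact le_csSup hbdd ⟨g, hg.1, hg.2, fun x hx => (hcoeff g x).2 (hgx x hx), rfl⟩
    have hsum : ∀ y : Fin n → ZMod 2, ∑ i, (y i).val < d →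
        ∑ z, (v + ∑ x, a x * cubeChar x z) * cubeChar y z = v * ∑ z, cubeChar y z := fun y hy => by
      simp only [add_mul, Finset.sum_add_distrib, ← Finset.mul_sum, Finset.sum_mul]
      rw [Finset.sum_comm, add_eq_left]
      refine Finset.sum_eq_zero fun x _ => ?_
      simp only [mul_assoc, ← cubeChar_add, ← Finset.mul_sum]
      by_cases hxy : x = y
      · rw [hxy, ha0 y hy, zero_mul]
      · rw [sum_cubeChar_of_ne_zero (mt cube_add_eq_zero_iff.1 hxy), mul_zero]
    have hw : ∀ z, 0 ≤ v + ∑ x, a x * cubeChar x z := fun z =>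
      le_trans (by split_ifs <;> norm_num) (ha z)
    refine le_trans ?_ (div_le_thetaCompl17 (d := d) hv0 hw ?_ fun y hy hyd => ?_)
    · have h1 := ha 0
      rw [if_pos rfl] at h1
      gcongr
    · have h1 := hsum 0 (by simp; omega)
      rw [sum_cubeChar_zero] at h1
      simpa [cubeChar_zero_left, mul_comm] using h1
    · rw [hsum y hyd, sum_cubeChar_of_ne_zero hy, mul_zero]
  have hM0 : 0 < sSup S := by linarith
  have hθ : 0 < thetaCompl17 n d :=
    lt_of_lt_of_le (by positivity) (hdual (sSup S / 2 ^ n + 1) (by linarith))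
  have h1 : 1 / thetaCompl17 n d ≤ sSup S / 2 ^ n := by
    refine le_of_forall_gt_imp_ge_of_dense fun v hv => ?_
    have hv0 : 0 < v := lt_trans (by positivity) hv
    exact (one_div_le hv0 hθ).1 (hdual v hv)
  rw [div_le_div_iff₀ hθ hN] at h1
  rw [div_le_iff₀ hM0]
  linarith
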